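/- arXiv:1802.10474 — 6 statements merged into one kernel-verified Lean document; each statement's English description precedes it below -/
import Mathlib

section
/- Let H, r, q be integers with 2 ≤ r ≤ H and q ≥ 1, and let T be an r-element subset of Fin H. Then the number of q-element sets Q whose members are (r−1)-element subsets of Fin H such that exactly one member of Q is a subset of T and T is not a subset of the union of the members of Q equals r·C(C(H−1,r−1) − 1, q−1). -/
open Finset in
/-- The number of `q`-element subsets of `S` containing a fixed element of `S`. -/
theorem card_image_insert_powersetCard {α : Type*} [DecidableEq α] (S : Finset α) (a : α)
    (ha : a ∈ S) (k : ℕ) :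
    (((S.erase a).powersetCard k).image (insert a)).card = (S.card - 1).choose k := by
  rw [card_image_of_injOn, card_powersetCard, card_erase_of_mem ha]
  intro A hA B hB hAB
  have hA' : a ∉ A := fun h => by simpa using (mem_powersetCard.1 hA).1 h
  have hB' : a ∉ B := fun h => by simpa using (mem_powersetCard.1 hB).1 h
  rw [← erase_insert hA', ← erase_insert hB']
  exact congrArg (fun X => X.erase a) hAB

open Finset in
theorem mem_image_insert_powersetCard {α : Type*} [DecidableEq α] {S : Finset α} {a : α}
    (ha : a ∈ S) {q : ℕ} (hq : 1 ≤ q) {Q : Finset α} :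
    Q ∈ ((S.erase a).powersetCard (q - 1)).image (insert a) ↔
      Q.card = q ∧ a ∈ Q ∧ Q ⊆ S := by
  simp only [mem_image, mem_powersetCard]
  constructor
  · rintro ⟨A, ⟨hA, hc⟩, rfl⟩
    have hA' : a ∉ A := fun h => by simpa using hA h
    refine ⟨?_, mem_insert_self _ _, insert_subset ha (hA.trans (erase_subset _ _))⟩
    rw [card_insert_of_notMem hA', hc]
    omega
  · rintro ⟨hc, haQ, hQ⟩
    refine ⟨Q.erase a, ⟨erase_subset_erase a hQ, ?_⟩, insert_erase haQ⟩
    rw [card_erase_of_mem haQ, hc]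

open Finset in
/-- A collection of `(r - 1)`-sets has exactly one member inside the `r`-set `T` and does not
cover `T` iff it contains `T.erase x` and avoids `x`, for some `x ∈ T`. -/
theorem card_filter_subset_eq_one_and_not_cover_iff {α : Type*} [DecidableEq α] {r : ℕ}
    {T : Finset α} (hT : T.card = r) {Q : Finset (Finset α)} (hQ : ∀ Y ∈ Q, Y.card = r - 1) :
    ((Q.filter (fun Y => Y ⊆ T)).card = 1 ∧ ¬ T ⊆ Q.sup id) ↔
      ∃ x ∈ T, T.erase x ∈ Q ∧ ∀ Y ∈ Q, x ∉ Y := by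
  have eq_erase {x : α} (hx : x ∈ T) {Y : Finset α} (hY : Y ∈ Q) (hYT : Y ⊆ T) (hxY : x ∉ Y) :
      Y = T.erase x := by
    refine eq_of_subset_of_card_le (subset_erase.2 ⟨hYT, hxY⟩) ?_
    rw [card_erase_of_mem hx, hQ Y hY, hT]
  constructor
  · rintro ⟨h1, h2⟩
    obtain ⟨x, hx, hxQ⟩ := not_subset.1 h2
    have hxQ' : ∀ Y ∈ Q, x ∉ Y := fun Y hY hxY => hxQ (mem_sup.2 ⟨Y, hY, hxY⟩)
    obtain ⟨Y, hY⟩ := card_pos.1 (h1 ▸ Nat.one_pos)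
    obtain ⟨hYQ, hYT⟩ := mem_filter.1 hY
    exact ⟨x, hx, eq_erase hx hYQ hYT (hxQ' Y hYQ) ▸ hYQ, hxQ'⟩
  · rintro ⟨x, hx, hxT, hxQ⟩
    refine ⟨card_eq_one.2 ⟨T.erase x, ?_⟩, fun h => ?_⟩
    · ext Y
      rw [mem_filter, mem_singleton]
      constructor
      · rintro ⟨hY, hYT⟩
        exact eq_erase hx hY hYT (hxQ Y hY)
      · rintro rfl
        exact ⟨hxT, erase_subset _ _⟩
    · obtain ⟨Y, hY, hxY⟩ := mem_sup.1 (h hx)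
      exact hxQ Y hY hxY

/-- The number of q-element collections of (r−1)-element subsets of Fin H with
exactly one member contained in T and T not contained in the union of the members
equals r·C(C(H−1,r−1) − 1, q−1) (Class 2 count). -/
theorem stmt_3 (H r q : ℕ) (hr : 2 ≤ r) (hrH : r ≤ H) (hq : 1 ≤ q)
    (T : Finset (Fin H)) (hT : T.card = r) :
    (Finset.univ.filter (fun Q : Finset (Finset (Fin H)) =>
        Q.card = q ∧ (∀ Y ∈ Q, Y.card = r - 1) ∧
        (Q.filter (fun Y => Y ⊆ T)).card = 1 ∧ ¬ T ⊆ Q.sup id)).card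
    = r * ((H - 1).choose (r - 1) - 1).choose (q - 1) := by
  set S : Fin H → Finset (Finset (Fin H)) := fun x => (Finset.univ.erase x).powersetCard (r - 1)
    with hS
  have memS {x : Fin H} {Y : Finset (Fin H)} : Y ∈ S x ↔ Y.card = r - 1 ∧ x ∉ Y := by
    simp [hS, Finset.mem_powersetCard, Finset.subset_erase, and_comm]
  have ha {x : Fin H} (hx : x ∈ T) : T.erase x ∈ S x :=
    memS.2 ⟨by rw [Finset.card_erase_of_mem hx, hT], Finset.notMem_erase x T⟩
  set F : Fin H → Finset (Finset (Finset (Fin H))) := fun x =>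
    (((S x).erase (T.erase x)).powersetCard (q - 1)).image (insert (T.erase x)) with hF
  have memF {x : Fin H} (hx : x ∈ T) {Q : Finset (Finset (Fin H))} :
      Q ∈ F x ↔ Q.card = q ∧ T.erase x ∈ Q ∧ Q ⊆ S x :=
    mem_image_insert_powersetCard (ha hx) hq
  have key : Finset.univ.filter (fun Q : Finset (Finset (Fin H)) =>
      Q.card = q ∧ (∀ Y ∈ Q, Y.card = r - 1) ∧
      (Q.filter (fun Y => Y ⊆ T)).card = 1 ∧ ¬ T ⊆ Q.sup id) = T.biUnion F := by
    ext Q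
    rw [Finset.mem_filter, Finset.mem_biUnion]
    constructor
    · rintro ⟨-, hc, hQ, h⟩
      obtain ⟨x, hx, hxT, hxQ⟩ := (card_filter_subset_eq_one_and_not_cover_iff hT hQ).1 h
      exact ⟨x, hx, (memF hx).2 ⟨hc, hxT, fun Y hY => memS.2 ⟨hQ Y hY, hxQ Y hY⟩⟩⟩
    · rintro ⟨x, hx, hQF⟩
      obtain ⟨hc, hxT, hQS⟩ := (memF hx).1 hQF
      have hQ : ∀ Y ∈ Q, Y.card = r - 1 := fun Y hY => (memS.1 (hQS hY)).1
      exact ⟨Finset.mem_univ _, hc, hQ, (card_filter_subset_eq_one_and_not_cover_iff hT hQ).2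
        ⟨x, hx, hxT, fun Y hY => (memS.1 (hQS hY)).2⟩⟩
  have disj : (T : Set (Fin H)).PairwiseDisjoint F := by
    intro x hx y hy hxy
    refine Finset.disjoint_left.2 fun Q hQx hQy => ?_
    have hxT := ((memF hx).1 hQx).2.1
    exact (memS.1 (((memF hy).1 hQy).2.2 hxT)).2 (Finset.mem_erase.2 ⟨hxy.symm, hy⟩)
  rw [key, Finset.card_biUnion disj,
    Finset.sum_const_nat (m := ((H - 1).choose (r - 1) - 1).choose (q - 1)), hT]
  intro x hx
  rw [hF, card_image_insert_powersetCard _ _ (ha hx), hS, Finset.card_powersetCard,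
    Finset.card_erase_of_mem (Finset.mem_univ x), Finset.card_univ, Fintype.card_fin]
end

section
/- Fix integers 1 ≤ r ≤ H and a relay h ∈ Fin H. Let U_h be the Finset of all r-element Finsets A of Fin H with h ∈ A. Let T ∈ U_h, let J ⊆ U_h with T ∈ J, let M = U_h \ J, and let Q′ = {A \ {h} : A ∈ M} ∪ {T \ {h}}. Then {A ∈ U_h : no member of Q′ is a subset of A} = J \ {T}. -/
/-- If `a ∈ A` and `A`, `B` have equal size, then an inclusion in `A` of `B` with `a` deleted
already forces `B = A`. -/
theorem Finset.erase_subset_iff_eq_of_mem_of_card_eq {α : Type*} [DecidableEq α]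
    {A B : Finset α} {a : α} (hA : a ∈ A) (hcard : A.card = B.card) :
    B.erase a ⊆ A ↔ B = A := by
  rw [← Finset.subset_insert_iff, Finset.insert_eq_of_mem hA]
  exact ⟨fun hBA => Finset.eq_of_subset_of_card_le hBA hcard.le, fun hBA => hBA.subset⟩

/-- The users connected to relay h covered by no member of the constructed
collection Q′ are exactly J \ {T}. -/
theorem stmt_6 (H r : ℕ) (hr : 1 ≤ r) (hrH : r ≤ H) (h : Fin H)
    (Uh : Finset (Finset (Fin H)))
    (hUh : Uh = Finset.univ.filter (fun A : Finset (Fin H) => A.card = r ∧ h ∈ A))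
    (T : Finset (Fin H)) (hT : T ∈ Uh)
    (J : Finset (Finset (Fin H))) (hJ : J ⊆ Uh) (hTJ : T ∈ J)
    (M Q' : Finset (Finset (Fin H)))
    (hM : M = Uh \ J)
    (hQ' : Q' = M.image (fun A => A.erase h) ∪ {T.erase h}) :
    Uh.filter (fun A => ∀ Y ∈ Q', ¬ Y ⊆ A) = J.erase T := by
  have key : ∀ A ∈ Uh, ∀ B ∈ Uh, (B.erase h ⊆ A ↔ B = A) := by
    intro A hA B hB
    simp only [hUh, Finset.mem_filter, Finset.mem_univ, true_and] at hA hB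
    exact Finset.erase_subset_iff_eq_of_mem_of_card_eq hA.2 (hA.1.trans hB.1.symm)
  ext A
  simp only [Finset.mem_filter, Finset.mem_erase, hQ', hM, Finset.mem_union, Finset.mem_image,
    Finset.mem_sdiff, Finset.mem_singleton]
  constructor
  · rintro ⟨hA, hcov⟩
    refine ⟨?_, ?_⟩
    · rintro rfl
      exact hcov _ (Or.inr rfl) (Finset.erase_subset h A)
    · by_contra hAJ
      exact hcov _ (Or.inl ⟨A, ⟨hA, hAJ⟩, rfl⟩) (Finset.erase_subset h A)
  · rintro ⟨hAT, hAJ⟩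
    refine ⟨hJ hAJ, ?_⟩
    rintro Y (⟨B, ⟨hB, hBJ⟩, rfl⟩ | rfl) hYA
    · exact hBJ ((key A (hJ hAJ) B hB).1 hYA ▸ hAJ)
    · exact hAT ((key A (hJ hAJ) T hT).1 hYA).symm
end

section
/- Fix integers 2 ≤ r ≤ H, an r-element Finset T of Fin H, and an integer g with 1 ≤ g ≤ K′ where K′ = C(H−1,r−1); set q = K′ − g + 1. For h ∈ Fin H let U_h be the Finset of r-element Finsets of Fin H containing h. Then the map (h, J) ↦ {A \ {h} : A ∈ U_h \ J} ∪ {T \ {h}} is a bijection from the set of pairs (h, J) with h ∈ T, J ⊆ U_h, T ∈ J, |J| = g, onto the set of q-element collections Q of (r−1)-element Finsets of Fin H such that exactly one member of Q is a subset of T and T is not a subset of ∪Q. -/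
open Finset in
/-- The number of `r`-element sets of a finite type through a given point. -/
theorem card_filter_card_eq_and_mem {α : Type*} [Fintype α] [DecidableEq α] {r : ℕ} (hr : 1 ≤ r)
    (h : α) :
    #{A : Finset α | #A = r ∧ h ∈ A} = (Fintype.card α - 1).choose (r - 1) := by
  rw [← card_univ, ← card_erase_of_mem (mem_univ h), ← card_powersetCard]
  refine card_nbij' (fun A => A.erase h) (fun B => insert h B) ?_ ?_ ?_ ?_
  · intro A hA
    simp only [coe_filter, mem_univ, true_and, Set.mem_ofPred_eq] at hA
    simp only [mem_coe, mem_powersetCard]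
    exact ⟨erase_subset_erase h (subset_univ A), by rw [card_erase_of_mem hA.2, hA.1]⟩
  · intro B hB
    simp only [mem_coe, mem_powersetCard] at hB
    have hB' : h ∉ B := fun hh => notMem_erase h univ (hB.1 hh)
    simp only [coe_filter, mem_univ, true_and, Set.mem_ofPred_eq]
    exact ⟨by rw [card_insert_of_notMem hB', hB.2]; omega, mem_insert_self h B⟩
  · intro A hA
    simp only [coe_filter, mem_univ, true_and, Set.mem_ofPred_eq] at hA
    exact insert_erase hA.2
  · intro B hB
    simp only [mem_coe, mem_powersetCard] at hB
    exact erase_insert fun hh => notMem_erase h univ (hB.1 hh)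

section ErasedFamily

open Finset

variable {α : Type*} [DecidableEq α] {h : α} {T : Finset α} {V J : Finset (Finset α)}

theorem erase_mem_image_erase_iff (hV : ∀ A ∈ V, h ∈ A) {A : Finset α} (hA : h ∈ A) :
    A.erase h ∈ V.image (fun B => B.erase h) ↔ A ∈ V := by
  refine ⟨fun hm => ?_, fun hm => mem_image_of_mem (fun B => B.erase h) hm⟩
  obtain ⟨B, hB, hBA⟩ := mem_image.1 hm
  rwa [← erase_injOn' h (hV B hB) hA hBA]

theorem card_image_erase_union_add_card (hV : ∀ A ∈ V, h ∈ A) (hJ : J ⊆ V) (hT : T ∈ J) :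
    #((V \ J).image (fun A => A.erase h) ∪ {T.erase h}) + #J = #V + 1 := by
  have hV' : ∀ A ∈ V \ J, h ∈ A := fun A hA => hV A (mem_sdiff.1 hA).1
  have hdisj : T.erase h ∉ (V \ J).image (fun A => A.erase h) := by
    rw [erase_mem_image_erase_iff hV' (hV T (hJ hT))]
    simp [hT]
  rw [card_union_of_disjoint (disjoint_singleton_right.2 hdisj), card_singleton,
    card_image_of_injOn fun A hA B hB => erase_injOn' h (hV' A hA) (hV' B hB)]
  have := card_sdiff_add_card_eq_card hJ
  omega

theorem filter_subset_image_erase_union {r : ℕ} (hV : ∀ A ∈ V, #A = r ∧ h ∈ A) (hJ : J ⊆ V)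
    (hT : T ∈ J) :
    ((V \ J).image (fun A => A.erase h) ∪ {T.erase h}).filter (fun Y => Y ⊆ T) =
      {T.erase h} := by
  obtain ⟨hTr, hhT⟩ := hV T (hJ hT)
  ext Y
  simp only [mem_filter, mem_union, mem_image, mem_sdiff, mem_singleton]
  constructor
  · rintro ⟨⟨A, ⟨hA, hAJ⟩, rfl⟩ | rfl, hY⟩
    · obtain ⟨hAr, hhA⟩ := hV A hA
      have hAT : A ⊆ T := by
        rw [← insert_erase hhA]
        exact insert_subset hhT hY
      exact absurd (eq_of_subset_of_card_le hAT (by omega) ▸ hT) hAJ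
    · rfl
  · rintro rfl
    exact ⟨Or.inr rfl, erase_subset h T⟩

theorem notMem_sup_image_erase_union :
    h ∉ ((V \ J).image (fun A => A.erase h) ∪ {T.erase h}).sup id := by
  simp only [mem_sup, mem_union, mem_image, mem_singleton, id]
  rintro ⟨Y, ⟨A, -, rfl⟩ | rfl, hY⟩ <;> exact notMem_erase h _ hY

/-- Removing `h` from the members of `V \ J`, and adding `T.erase h`, determines `J`. -/
theorem mem_iff_of_image_erase_union (hV : ∀ A ∈ V, h ∈ A) (hJ : J ⊆ V) (hT : T ∈ J)
    (A : Finset α) :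
    A ∈ J ↔ A ∈ V ∧
      (A = T ∨ A.erase h ∉ (V \ J).image (fun A => A.erase h) ∪ {T.erase h}) := by
  have hV' : ∀ A ∈ V \ J, h ∈ A := fun A hA => hV A (mem_sdiff.1 hA).1
  by_cases hA : A ∈ V
  · have hinj : A.erase h = T.erase h ↔ A = T :=
      (erase_injOn' h).eq_iff (hV A hA) (hV T (hJ hT))
    rw [mem_union, erase_mem_image_erase_iff hV' (hV A hA), mem_singleton, hinj, mem_sdiff]
    by_cases hAT : A = T
    · simp [hAT, hT, hJ hT]
    · simp [hAT, hA]
  · exact ⟨fun hAJ => absurd (hJ hAJ) hA, fun hAV => absurd hAV.1 hA⟩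

end ErasedFamily


/-- The map (h, J) ↦ {A \ {h} : A ∈ U_h \ J} ∪ {T \ {h}} is a bijection from the
pairs (h, J) with h ∈ T, J ⊆ U_h, T ∈ J, |J| = g onto the q-element collections of
(r−1)-element subsets of Fin H with exactly one member contained in T and
T ⊄ ∪Q, where q = K′ − g + 1. -/
theorem stmt_8 (H r g q K' : ℕ) (hr : 2 ≤ r) (hrH : r ≤ H)
    (hK' : K' = (H - 1).choose (r - 1))
    (hg1 : 1 ≤ g) (hgK' : g ≤ K') (hq : q = K' - g + 1)
    (T : Finset (Fin H)) (hT : T.card = r)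
    (U : Fin H → Finset (Finset (Fin H)))
    (hU : ∀ h : Fin H,
      U h = Finset.univ.filter (fun A : Finset (Fin H) => A.card = r ∧ h ∈ A)) :
    Set.BijOn
      (fun p : Fin H × Finset (Finset (Fin H)) =>
        ((U p.1 \ p.2).image (fun A => A.erase p.1)) ∪ {T.erase p.1})
      {p : Fin H × Finset (Finset (Fin H)) |
        p.1 ∈ T ∧ p.2 ⊆ U p.1 ∧ T ∈ p.2 ∧ p.2.card = g}
      {Q : Finset (Finset (Fin H)) |
        Q.card = q ∧ (∀ Y ∈ Q, Y.card = r - 1) ∧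
        (Q.filter (fun Y => Y ⊆ T)).card = 1 ∧ ¬ T ⊆ Q.sup id} := by
  have hV : ∀ h, ∀ A ∈ U h, A.card = r ∧ h ∈ A := by
    intro h A hA
    simpa [hU] using hA
  have hVm : ∀ h, ∀ A ∈ U h, h ∈ A := fun h A hA => (hV h A hA).2
  have hUcard : ∀ h, (U h).card = K' := by
    intro h
    rw [hU, card_filter_card_eq_and_mem (by omega) h, Fintype.card_fin, hK']
  refine ⟨?_, ?_, ?_⟩
  · rintro ⟨h, J⟩ ⟨hhT, hJ, hTJ, hJg⟩
    dsimp only at hhT hJ hTJ hJg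
    refine ⟨?_, ?_, ?_, fun hsub => notMem_sup_image_erase_union (hsub hhT)⟩
    · have := card_image_erase_union_add_card (hVm h) hJ hTJ
      rw [hUcard] at this
      dsimp only
      omega
    · intro Y hY
      simp only [Finset.mem_union, Finset.mem_image, Finset.mem_sdiff,
        Finset.mem_singleton] at hY
      rcases hY with ⟨A, ⟨hA, -⟩, rfl⟩ | rfl
      · rw [Finset.card_erase_of_mem (hVm h A hA), (hV h A hA).1]
      · rw [Finset.card_erase_of_mem hhT, hT]
    · dsimp only
      rw [filter_subset_image_erase_union (hV h) hJ hTJ, Finset.card_singleton]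
  · rintro ⟨h, J⟩ ⟨hhT, hJ, hTJ, -⟩ ⟨h', J'⟩ ⟨hhT', hJ', hTJ', -⟩ heq
    dsimp only at hhT hJ hTJ hhT' hJ' hTJ' heq
    have herase : T.erase h = T.erase h' := by
      rw [← Finset.singleton_inj, ← filter_subset_image_erase_union (hV h) hJ hTJ, heq,
        filter_subset_image_erase_union (hV h') hJ' hTJ']
    obtain rfl : h = h' := (Finset.erase_inj T hhT).1 herase
    congr 1
    ext A
    rw [mem_iff_of_image_erase_union (hVm h) hJ hTJ, heq,
      ← mem_iff_of_image_erase_union (hVm h) hJ' hTJ']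
  · rintro Q ⟨hQq, hQr, hQT, hQsup⟩
    obtain ⟨h, hhT, hhQ⟩ := Finset.not_subset.1 hQsup
    have hnot : ∀ Y ∈ Q, h ∉ Y := fun Y hY hhY => hhQ (Finset.mem_sup.2 ⟨Y, hY, hhY⟩)
    obtain ⟨Y₀, hY₀⟩ := Finset.card_eq_one.1 hQT
    obtain ⟨hY₀Q, hY₀T⟩ := Finset.mem_filter.1 (hY₀ ▸ Finset.mem_singleton_self Y₀)
    have hY₀eq : Y₀ = T.erase h := by
      refine Finset.eq_of_subset_of_card_le
        (Finset.subset_erase.2 ⟨hY₀T, hnot Y₀ hY₀Q⟩) ?_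
      rw [Finset.card_erase_of_mem hhT, hQr Y₀ hY₀Q, hT]
    subst hY₀eq
    set J := (U h).filter (fun A => A = T ∨ A.erase h ∉ Q) with hJdef
    have hJ : J ⊆ U h := Finset.filter_subset _ _
    have hTJ : T ∈ J := by simp [hJdef, hU, hT, hhT]
    have himage : ((U h \ J).image (fun A => A.erase h)) ∪ {T.erase h} = Q := by
      ext Y
      simp only [Finset.mem_union, Finset.mem_image, Finset.mem_sdiff, Finset.mem_singleton]
      constructor
      · rintro (⟨A, ⟨hA, hAJ⟩, rfl⟩ | rfl)
        · by_contra hAQ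
          exact hAJ (Finset.mem_filter.2 ⟨hA, Or.inr hAQ⟩)
        · exact hY₀Q
      · intro hY
        by_cases hYT : Y = T.erase h
        · exact Or.inr hYT
        · have hYe : (insert h Y).erase h = Y := Finset.erase_insert (hnot Y hY)
          refine Or.inl ⟨insert h Y, ⟨?_, fun hYJ => ?_⟩, hYe⟩
          · have hcard : (insert h Y).card = r := by
              rw [Finset.card_insert_of_notMem (hnot Y hY), hQr Y hY]
              omega
            simp [hU, hcard]
          · rcases (Finset.mem_filter.1 hYJ).2 with hins | hins
            · exact hYT (by rw [← hins, hYe])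
            · exact hins (hYe.symm ▸ hY)
    refine ⟨(h, J), ⟨hhT, hJ, hTJ, ?_⟩, himage⟩
    have := card_image_erase_union_add_card (hVm h) hJ hTJ
    rw [himage, hUcard] at this
    dsimp only
    omega
end

section
/- Let u be a positive real number. Then the function f(x) = (x/(x−u))^(x/u) is strictly decreasing on the interval (u, ∞): for all real numbers x₁, x₂ with u < x₁ < x₂, one has (x₂/(x₂−u))^(x₂/u) < (x₁/(x₁−u))^(x₁/u). -/
/-- The function x ↦ (x/(x−u))^(x/u) is strictly decreasing on (u, ∞) for u > 0. -/
theorem stmt_11 (u x₁ x₂ : ℝ) (hu : 0 < u) (h1 : u < x₁) (h12 : x₁ < x₂) :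
    (x₂ / (x₂ - u)) ^ (x₂ / u) < (x₁ / (x₁ - u)) ^ (x₁ / u) := by
  have hx₁ : 0 < x₁ := hu.trans h1
  have hx₂ : 0 < x₂ := hx₁.trans h12
  have hd₁ : 0 < x₁ - u := sub_pos.2 h1
  have hd₂ : 0 < x₂ - u := sub_pos.2 (h1.trans h12)
  have hs : 1 + -(u / x₂) = (x₂ - u) / x₂ := by field_simp; ring
  have hps : 1 + x₂ / x₁ * -(u / x₂) = (x₁ - u) / x₁ := by field_simp; ring
  have bernoulli : (x₁ - u) / x₁ < ((x₂ - u) / x₂) ^ (x₂ / x₁) := by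
    have hlt : u / x₂ < 1 := (div_lt_one hx₂).2 (h1.trans h12)
    have h := one_add_mul_self_lt_rpow_one_add (s := -(u / x₂)) (by linarith)
      (neg_ne_zero.2 (div_pos hu hx₂).ne') ((one_lt_div hx₁).2 h12)
    rwa [hs, hps] at h
  have key : ((x₁ - u) / x₁) ^ (x₁ / u) < ((x₂ - u) / x₂) ^ (x₂ / u) := by
    have h := Real.rpow_lt_rpow (by positivity) bernoulli (div_pos hx₁ hu)
    rwa [← Real.rpow_mul (by positivity), div_mul_div_cancel₀ hx₁.ne'] at h
  rw [← inv_div (x₂ - u), ← inv_div (x₁ - u), Real.inv_rpow (by positivity),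
    Real.inv_rpow (by positivity)]
  exact inv_strictAnti₀ (by positivity) key
end

section
/- For all real numbers u and x with u ≥ 7 and x ≥ u + 2, one has (x/(x−u))^(x/u) < u. -/
/-- On `(u, ∞)` the function `x ↦ x * log (x / (x - u))` is antitone, by Bernoulli. -/
theorem mul_log_div_sub_le {u x y : ℝ} (hu : 0 < u) (hy : u < y) (hyx : y ≤ x) :
    x * Real.log (x / (x - u)) ≤ y * Real.log (y / (y - u)) := by
  have hy0 : 0 < y := hu.trans hy
  have hx0 : 0 < x := hy0.trans_le hyx
  have hyu : 0 < y - u := sub_pos.2 hy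
  have hxu : 0 < x - u := by linarith
  have hs : 1 + -(u / y) = (y - u) / y := by field_simp; ring
  have bernoulli := rpow_one_add_le_one_add_mul_self (s := -(u / y)) (p := y / x)
    (by linarith [(div_le_one hy0).2 hy.le]) (by positivity) ((div_le_one hx0).2 hyx)
  have hp : 1 + y / x * -(u / y) = (x - u) / x := by field_simp; ring
  rw [hs, hp] at bernoulli
  have hlog := Real.log_le_log (by positivity) bernoulli
  rw [Real.log_rpow (by positivity), ← inv_div y, ← inv_div x (x - u), Real.log_inv,
    Real.log_inv, mul_neg, neg_le_neg_iff, div_mul_eq_mul_div, le_div_iff₀ hx0] at hlog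
  linarith

theorem monotoneOn_mul_log_sub_mul_log_half :
    MonotoneOn (fun u : ℝ => u * Real.log u - (u + 2) * Real.log ((u + 2) / 2))
      (Set.Ici 2) := by
  have hderiv (u : ℝ) (hu : 2 ≤ u) :
      HasDerivAt (fun u : ℝ => u * Real.log u - (u + 2) * Real.log ((u + 2) / 2))
        (Real.log u - Real.log ((u + 2) / 2)) u := by
    have h₁ : HasDerivAt (fun u : ℝ => u + 2) 1 u := (hasDerivAt_id' u).add_const 2
    have h₂ := (h₁.div_const 2).log (by positivity)
    convert! (Real.hasDerivAt_mul_log (by positivity : u ≠ 0)).sub (h₁.mul h₂) using 1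
    field_simp
    ring
  refine monotoneOn_of_deriv_nonneg (convex_Ici 2)
    (fun u hu => (hderiv u hu).continuousAt.continuousWithinAt) ?_ ?_
  · intro u hu
    exact (hderiv u (interior_subset hu)).differentiableAt.differentiableWithinAt
  · intro u hu
    have hu2 : 2 ≤ u := interior_subset hu
    rw [(hderiv u hu2).deriv, sub_nonneg]
    exact Real.log_le_log (by positivity) (by linarith)

theorem add_two_mul_log_half_lt {u : ℝ} (hu : 7 ≤ u) :
    (u + 2) * Real.log ((u + 2) / 2) < u * Real.log u := by
  have hmono := monotoneOn_mul_log_sub_mul_log_half (show (7 : ℝ) ∈ Set.Ici 2 by norm_num)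
    (show u ∈ Set.Ici 2 from le_trans (by norm_num) hu) hu
  have hseven : (9 : ℝ) * Real.log (9 / 2) < 7 * Real.log 7 := by
    have h : Real.log ((9 / 2 : ℝ) ^ 9) < Real.log ((7 : ℝ) ^ 7) :=
      Real.log_lt_log (by norm_num) (by norm_num)
    rw [Real.log_pow, Real.log_pow] at h
    exact_mod_cast h
  norm_num at hmono
  linarith

/-- For u ≥ 7 and x ≥ u + 2 one has (x/(x−u))^(x/u) < u. -/
theorem stmt_12 (u x : ℝ) (hu : 7 ≤ u) (hx : u + 2 ≤ x) :
    (x / (x - u)) ^ (x / u) < u := by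
  have hu0 : 0 < u := by linarith
  have hx0 : 0 < x := by linarith
  have hxu : 0 < x - u := by linarith
  have hle := mul_log_div_sub_le hu0 (by linarith : u < u + 2) hx
  rw [add_sub_cancel_left] at hle
  rw [← Real.log_lt_log_iff (by positivity) hu0, Real.log_rpow (by positivity),
    div_mul_eq_mul_div, div_lt_iff₀' hu0]
  exact hle.trans_lt (add_two_mul_log_half_lt hu)
end

section
/- Let 1 ≤ r ≤ H, let Q be a Finset whose members are (r−1)-element Finsets of Fin H, and let T be an r-element Finset of Fin H such that T ⊆ ∪Q and at least one member of Q is a subset of T. Then for every h ∈ T, the number of r-element Finsets A of Fin H with h ∈ A such that no member of Q is a subset of A is at most C(H−1,r−1) − (H − r + 1). -/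
/-- The number of `(k + 1)`-element sets containing a fixed element `h`. -/
theorem card_filter_card_eq_succ_and_mem {α : Type*} [Fintype α] [DecidableEq α] (k : ℕ) (h : α) :
    (Finset.univ.filter (fun A : Finset α => A.card = k + 1 ∧ h ∈ A)).card
      = (Fintype.card α - 1).choose k := by
  rw [← Finset.card_univ, ← Finset.card_erase_of_mem (Finset.mem_univ h),
    ← Finset.card_powersetCard]
  refine Finset.card_nbij' (fun A => A.erase h) (fun B => insert h B) ?_ ?_ ?_ ?_
  · intro A hA
    obtain ⟨hc, hh⟩ : A.card = k + 1 ∧ h ∈ A := by simpa using hA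
    simp only [Finset.mem_coe, Finset.mem_powersetCard]
    exact ⟨Finset.erase_subset_erase h (Finset.subset_univ A),
      by rw [Finset.card_erase_of_mem hh, hc, Nat.add_sub_cancel]⟩
  · intro B hB
    obtain ⟨hs, hc⟩ := Finset.mem_powersetCard.mp hB
    have hh : h ∉ B := fun hb => Finset.notMem_erase h _ (hs hb)
    simp [Finset.card_insert_of_notMem hh, hc]
  · intro A hA
    obtain ⟨-, hh⟩ : A.card = k + 1 ∧ h ∈ A := by simpa using hA
    exact Finset.insert_erase hh
  · intro B hB
    have hs := (Finset.mem_powersetCard.mp hB).1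
    exact Finset.erase_insert fun hb => Finset.notMem_erase h _ (hs hb)

/-- The sets obtained from `Y` by adding one new element are as many as the elements outside
`Y`. -/
theorem card_image_insert_compl {α : Type*} [Fintype α] [DecidableEq α] (Y : Finset α) :
    (Yᶜ.image (fun x => insert x Y)).card = Fintype.card α - Y.card := by
  rw [Finset.card_image_of_injOn, Finset.card_compl]
  intro a ha b _ hab
  have ha' : a ∉ Y := by simpa using ha
  exact (Finset.insert_inj ha').mp hab

/-- The Class 3 bound: if T ⊆ ∪Q and some member of Q is contained in T, then for
every h ∈ T the number of users connected to h covered by no member of Q is at most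
C(H−1,r−1) − (H−r+1). -/
theorem stmt_19 (H r : ℕ) (hr : 1 ≤ r) (hrH : r ≤ H)
    (Q : Finset (Finset (Fin H))) (hQ : ∀ Y ∈ Q, Y.card = r - 1)
    (T : Finset (Fin H)) (hT : T.card = r)
    (hTQ : T ⊆ Q.sup id) (hY : ∃ Y ∈ Q, Y ⊆ T) :
    ∀ h ∈ T,
      (Finset.univ.filter (fun A : Finset (Fin H) =>
          A.card = r ∧ h ∈ A ∧ ∀ Y ∈ Q, ¬ Y ⊆ A)).card
        ≤ (H - 1).choose (r - 1) - (H - r + 1) := by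
  intro h hh
  obtain ⟨Y, hYQ, hhY⟩ := Finset.mem_sup.mp (hTQ hh)
  simp only [id] at hhY
  obtain ⟨k, rfl⟩ : ∃ k, r = k + 1 := ⟨r - 1, by omega⟩
  have hYc : Y.card = k := by simpa using hQ Y hYQ
  have hP := card_image_insert_compl Y
  have hU := card_filter_card_eq_succ_and_mem k h
  rw [Fintype.card_fin] at hP hU
  set S := Finset.univ.filter (fun A : Finset (Fin H) =>
    A.card = k + 1 ∧ h ∈ A ∧ ∀ Y ∈ Q, ¬ Y ⊆ A)
  have hdisj : Disjoint S (Yᶜ.image (fun x => insert x Y)) := by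
    rw [Finset.disjoint_left]
    intro A hA hA'
    obtain ⟨x, -, rfl⟩ := Finset.mem_image.mp hA'
    exact (Finset.mem_filter.mp hA).2.2.2 Y hYQ (Finset.subset_insert x Y)
  have hsub : S ∪ Yᶜ.image (fun x => insert x Y) ⊆
      Finset.univ.filter (fun A : Finset (Fin H) => A.card = k + 1 ∧ h ∈ A) := by
    refine Finset.union_subset ?_ ?_
    · exact Finset.monotone_filter_right _ fun A _ hA => ⟨hA.1, hA.2.1⟩
    · intro A hA
      obtain ⟨x, hx, rfl⟩ := Finset.mem_image.mp hA
      simp [Finset.card_insert_of_notMem (Finset.mem_compl.mp hx), hYc, hhY]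
  have hle := Finset.card_le_card hsub
  rw [Finset.card_union_of_disjoint hdisj, hU, hP, hYc] at hle
  rw [Nat.add_sub_cancel]
  omega
end
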